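/- The differential entropy of a truncated product normal distribution on a finite disjoint union of boxes admits a closed form: let M ≥ 1, let μ, s : Fin M → ℝ with s m > 0, let J ≥ 1 and l, u : Fin J → Fin M → ℝ with l j m < u j m, assume the boxes B j = {z : Fin M → ℝ | ∀ m, l j m < z m ∧ z m ≤ u j m} are pairwise disjoint, and set D = ⋃_j B j. Let q(z) = ∏_m (1/√(s m)) · φ((z m − μ m)/√(s m)) be the product Gaussian density and define γ m c = (c − μ m)/√(s m), W[j,m] = Φ(γ m (u j m)) − Φ(γ m (l j m)), W[j] = ∏_m W[j,m], W = Σ_j W[j], and V[j,m] = γ m (u j m)·φ(γ m (u j m)) − γ m (l j m)·φ(γ m (l j m)) (note W > 0 follows from the hypotheses). Then, with respect to Lebesgue measure on Fin M → ℝ, −∫_{z ∈ D} (q(z)/W) · log(q(z)/W) dz = (M/2)·log(2·π·e) + (1/2)·Σ_m log(s m) + log W − (1/(2·W))·Σ_{j=1}^J W[j] · Σ_{m=1}^M V[j,m]/W[j,m]. -/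

import Mathlib

open MeasureTheory

noncomputable section

/-- The density of the standard normal distribution. -/
def stdPdf (z : ℝ) : ℝ := (Real.sqrt (2 * Real.pi))⁻¹ * Real.exp (-z ^ 2 / 2)

/-- The cumulative distribution function of the standard normal distribution. -/
def stdCdf (x : ℝ) : ℝ := ∫ z in Set.Iic x, stdPdf z

/-- The standardization map `γ m c = (c − μ m)/√(s m)`. -/
def gam {M : ℕ} (μ s : Fin M → ℝ) (m : Fin M) (c : ℝ) : ℝ :=
  (c - μ m) / Real.sqrt (s m)

/-- `W[j,m] = Φ(γ m (u j m)) − Φ(γ m (l j m))`. -/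
def Wjm {M J : ℕ} (μ s : Fin M → ℝ) (l u : Fin J → Fin M → ℝ) (j : Fin J) (m : Fin M) : ℝ :=
  stdCdf (gam μ s m (u j m)) - stdCdf (gam μ s m (l j m))

/-- `W[j] = ∏_m W[j,m]`. -/
def Wj {M J : ℕ} (μ s : Fin M → ℝ) (l u : Fin J → Fin M → ℝ) (j : Fin J) : ℝ :=
  ∏ m, Wjm μ s l u j m

/-- `W = Σ_j W[j]`. -/
def Wtot {M J : ℕ} (μ s : Fin M → ℝ) (l u : Fin J → Fin M → ℝ) : ℝ :=
  ∑ j, Wj μ s l u j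

/-- `V[j,m] = γ m (u j m)·φ(γ m (u j m)) − γ m (l j m)·φ(γ m (l j m))`. -/
def Vjm {M J : ℕ} (μ s : Fin M → ℝ) (l u : Fin J → Fin M → ℝ) (j : Fin J) (m : Fin M) : ℝ :=
  gam μ s m (u j m) * stdPdf (gam μ s m (u j m))
    - gam μ s m (l j m) * stdPdf (gam μ s m (l j m))

/-- The union `D = ⋃_j B j` of the boxes `B j`. -/
def boxD {M J : ℕ} (l u : Fin J → Fin M → ℝ) : Set (Fin M → ℝ) :=
  ⋃ j, {z : Fin M → ℝ | ∀ m, l j m < z m ∧ z m ≤ u j m}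

/-- The product Gaussian density `q(z) = ∏_m (1/√(s m)) · φ((z m − μ m)/√(s m))`. -/
def gaussDensity {M : ℕ} (μ s : Fin M → ℝ) (z : Fin M → ℝ) : ℝ :=
  ∏ m, (1 / Real.sqrt (s m)) * stdPdf ((z m - μ m) / Real.sqrt (s m))

end

theorem stdPdf_pos (x : ℝ) : 0 < stdPdf x := by
  unfold stdPdf
  positivity

theorem continuous_stdPdf : Continuous stdPdf := by
  unfold stdPdf
  fun_prop

theorem integrable_stdPdf : Integrable stdPdf := by
  have h := (integrable_exp_neg_mul_sq (b := 1 / 2) (by norm_num)).const_mul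
    (Real.sqrt (2 * Real.pi))⁻¹
  refine h.congr (.of_forall fun x => ?_)
  simp only [stdPdf]
  ring_nf

theorem hasDerivAt_stdPdf (x : ℝ) : HasDerivAt stdPdf (-x * stdPdf x) x := by
  have h : HasDerivAt (fun z : ℝ => -z ^ 2 / 2) (-x) x := by
    convert! ((hasDerivAt_pow 2 x).neg.div_const 2) using 1
    push_cast
    ring
  convert! (h.exp.const_mul (Real.sqrt (2 * Real.pi))⁻¹) using 1
  simp only [stdPdf]
  ring

theorem hasDerivAt_stdCdf (x : ℝ) : HasDerivAt stdCdf (stdPdf x) x := by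
  have h : stdCdf = fun y => stdCdf 0 + ∫ z in (0 : ℝ)..y, stdPdf z := by
    funext y
    rw [← intervalIntegral.integral_Iic_sub_Iic integrable_stdPdf.integrableOn
      integrable_stdPdf.integrableOn]
    simp [stdCdf]
  rw [h]
  exact (continuous_stdPdf.integral_hasStrictDerivAt 0 x).hasDerivAt.const_add _

theorem strictMono_stdCdf : StrictMono stdCdf :=
  strictMono_of_deriv_pos fun x => by
    rw [(hasDerivAt_stdCdf x).deriv]
    exact stdPdf_pos x

theorem log_stdPdf (x : ℝ) :
    Real.log (stdPdf x) = -(1 / 2) * Real.log (2 * Real.pi) - x ^ 2 / 2 := by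
  rw [stdPdf, Real.log_mul (by positivity) (Real.exp_pos _).ne', Real.log_exp, Real.log_inv,
    Real.log_sqrt (by positivity)]
  ring

theorem log_inv_sqrt_mul_stdPdf {v : ℝ} (hv : 0 < v) (x : ℝ) :
    Real.log (1 / √v * stdPdf x)
      = -(1 / 2) * Real.log v - (1 / 2) * Real.log (2 * Real.pi) - x ^ 2 / 2 := by
  rw [Real.log_mul (by positivity) (stdPdf_pos x).ne', log_stdPdf, one_div, Real.log_inv,
    Real.log_sqrt hv.le]
  ring

theorem continuous_inv_sqrt_mul_stdPdf (c v : ℝ) :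
    Continuous fun t => 1 / √v * stdPdf ((t - c) / √v) :=
  continuous_const.mul (continuous_stdPdf.comp (by fun_prop))

theorem inv_sqrt_mul_stdPdf_pos {v : ℝ} (hv : 0 < v) (x : ℝ) : 0 < 1 / √v * stdPdf x :=
  mul_pos (by positivity) (stdPdf_pos x)

theorem hasDerivAt_standardize (c v t : ℝ) :
    HasDerivAt (fun t => (t - c) / √v) (1 / √v) t :=
  ((hasDerivAt_id t).sub_const c).div_const _

theorem intervalIntegral_inv_sqrt_mul_stdPdf (c v a b : ℝ) :
    ∫ t in a..b, 1 / √v * stdPdf ((t - c) / √v)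
      = stdCdf ((b - c) / √v) - stdCdf ((a - c) / √v) := by
  refine intervalIntegral.integral_eq_sub_of_hasDerivAt
    (f := fun t => stdCdf ((t - c) / √v)) (fun t _ => ?_)
    ((continuous_inv_sqrt_mul_stdPdf c v).intervalIntegrable a b)
  rw [mul_comm]
  exact (hasDerivAt_stdCdf _).comp t (hasDerivAt_standardize c v t)

theorem intervalIntegral_mul_log_inv_sqrt_mul_stdPdf (c : ℝ) {v : ℝ} (hv : 0 < v) (a b : ℝ) :
    ∫ t in a..b, 1 / √v * stdPdf ((t - c) / √v) * Real.log (1 / √v * stdPdf ((t - c) / √v))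
      = -(1 / 2) * (Real.log v + Real.log (2 * Real.pi * Real.exp 1))
            * (stdCdf ((b - c) / √v) - stdCdf ((a - c) / √v))
          + (1 / 2) * ((b - c) / √v * stdPdf ((b - c) / √v)
            - (a - c) / √v * stdPdf ((a - c) / √v)) := by
  have hcont := continuous_inv_sqrt_mul_stdPdf c v
  have hflog : Continuous fun t => 1 / √v * stdPdf ((t - c) / √v)
      * Real.log (1 / √v * stdPdf ((t - c) / √v)) :=
    hcont.mul (hcont.log fun t => (inv_sqrt_mul_stdPdf_pos hv _).ne')
  rw [intervalIntegral.integral_eq_sub_of_hasDerivAt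
    (f := fun t => -(1 / 2) * (Real.log v + Real.log (2 * Real.pi * Real.exp 1))
        * stdCdf ((t - c) / √v) + (1 / 2) * ((t - c) / √v * stdPdf ((t - c) / √v)))
    (fun t _ => ?_) (hflog.intervalIntegrable a b)]
  · ring
  · have hg := hasDerivAt_standardize c v t
    convert! (((hasDerivAt_stdCdf _).comp t hg).const_mul
      (-(1 / 2) * (Real.log v + Real.log (2 * Real.pi * Real.exp 1)))).add
      ((hg.mul ((hasDerivAt_stdPdf _).comp t hg)).const_mul (1 / 2)) using 1
    rw [log_inv_sqrt_mul_stdPdf hv, Real.log_mul (by positivity) (Real.exp_pos _).ne',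
      Real.log_exp, Function.comp_apply]
    ring

theorem setOf_forall_lt_le_eq_pi {ι : Type*} (a b : ι → ℝ) :
    {z : ι → ℝ | ∀ i, a i < z i ∧ z i ≤ b i} = Set.univ.pi fun i => Set.Ioc (a i) (b i) := by
  ext z
  simp

theorem setIntegral_pi_Ioc_prod {ι : Type*} [Fintype ι] {a b : ι → ℝ} (hab : ∀ i, a i ≤ b i)
    (f : ι → ℝ → ℝ) :
    ∫ z in Set.univ.pi fun i => Set.Ioc (a i) (b i), ∏ i, f i (z i)
      = ∏ i, ∫ t in a i..b i, f i t := by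
  rw [volume_pi, Measure.restrict_pi_pi, integral_fintype_prod_eq_prod]
  exact Finset.prod_congr rfl fun i _ => (intervalIntegral.integral_of_le (hab i)).symm

theorem integrableOn_pi_Ioc {ι : Type*} [Fintype ι] (a b : ι → ℝ) {f : (ι → ℝ) → ℝ}
    (hf : Continuous f) : IntegrableOn f (Set.univ.pi fun i => Set.Ioc (a i) (b i)) :=
  (hf.continuousOn.integrableOn_compact
    (isCompact_univ_pi fun i => isCompact_Icc (a := a i) (b := b i))).mono_set
    (Set.pi_mono fun _ _ => Set.Ioc_subset_Icc_self)

theorem prod_mul_log_prod_eq_sum {ι : Type*} [Fintype ι] [DecidableEq ι] {f : ι → ℝ}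
    (hf : ∀ i, f i ≠ 0) :
    (∏ i, f i) * Real.log (∏ i, f i)
      = ∑ k, ∏ i, if i = k then f i * Real.log (f i) else f i := by
  rw [Real.log_prod fun i _ => hf i, Finset.mul_sum]
  refine Finset.sum_congr rfl fun k _ => ?_
  rw [← Finset.mul_prod_erase _ _ (Finset.mem_univ k),
    ← Finset.mul_prod_erase _ (fun i => if i = k then f i * Real.log (f i) else f i)
      (Finset.mem_univ k),
    Finset.prod_congr rfl fun i hi => if_neg (Finset.ne_of_mem_erase hi)]
  simp only [if_true]
  ring

theorem setIntegral_pi_Ioc_prod_mul_log_prod {ι : Type*} [Fintype ι] {a b : ι → ℝ}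
    (hab : ∀ i, a i ≤ b i) {f : ι → ℝ → ℝ} (hf : ∀ i, Continuous (f i))
    (hpos : ∀ i t, 0 < f i t) (hint : ∀ i, ∫ t in a i..b i, f i t ≠ 0) :
    ∫ z in Set.univ.pi fun i => Set.Ioc (a i) (b i),
        (∏ i, f i (z i)) * Real.log (∏ i, f i (z i))
      = (∏ i, ∫ t in a i..b i, f i t)
          * ∑ k, (∫ t in a k..b k, f k t * Real.log (f k t)) / ∫ t in a k..b k, f k t := by
  classical
  have hg (k i : ι) : Continuous fun t => if i = k then f i t * Real.log (f i t) else f i t := by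
    split_ifs
    · exact (hf i).mul ((hf i).log fun t => (hpos i t).ne')
    · exact hf i
  have hprod (k : ι) : Continuous fun z : ι → ℝ =>
      ∏ i, if i = k then f i (z i) * Real.log (f i (z i)) else f i (z i) :=
    continuous_finsetProd _ fun i _ => (hg k i).comp (continuous_apply i)
  simp_rw [fun z : ι → ℝ => prod_mul_log_prod_eq_sum fun i => (hpos i (z i)).ne']
  rw [integral_finsetSum _ fun k _ => integrableOn_pi_Ioc a b (hprod k), Finset.mul_sum]
  refine Finset.sum_congr rfl fun k _ => ?_
  rw [setIntegral_pi_Ioc_prod hab fun i t => if i = k then f i t * Real.log (f i t) else f i t,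
    ← Finset.mul_prod_erase _ _ (Finset.mem_univ k),
    ← Finset.mul_prod_erase _ (fun i => ∫ t in a i..b i, f i t) (Finset.mem_univ k),
    Finset.prod_congr (g := fun i => ∫ t in a i..b i, f i t) rfl fun i hi => by
      simp only [if_neg (Finset.ne_of_mem_erase hi)]]
  have := hint k
  simp only [if_true]
  field_simp

theorem Wjm_pos {M J : ℕ} {μ s : Fin M → ℝ} (hs : ∀ m, 0 < s m) {l u : Fin J → Fin M → ℝ}
    (hlu : ∀ j m, l j m < u j m) (j : Fin J) (m : Fin M) : 0 < Wjm μ s l u j m :=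
  sub_pos.2 <| strictMono_stdCdf <|
    div_lt_div_of_pos_right (sub_lt_sub_right (hlu j m) _) (Real.sqrt_pos.2 (hs m))

theorem gaussDensity_pos {M : ℕ} {μ s : Fin M → ℝ} (hs : ∀ m, 0 < s m) (z : Fin M → ℝ) :
    0 < gaussDensity μ s z :=
  Finset.prod_pos fun m _ => inv_sqrt_mul_stdPdf_pos (hs m) _

theorem continuous_gaussDensity {M : ℕ} (μ s : Fin M → ℝ) : Continuous (gaussDensity μ s) :=
  continuous_finsetProd _ fun m _ =>
    (continuous_inv_sqrt_mul_stdPdf (μ m) (s m)).comp (continuous_apply m)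

theorem setIntegral_gaussDensity {M J : ℕ} (μ s : Fin M → ℝ) {l u : Fin J → Fin M → ℝ}
    (hlu : ∀ j m, l j m < u j m) (j : Fin J) :
    ∫ z in Set.univ.pi fun m => Set.Ioc (l j m) (u j m), gaussDensity μ s z = Wj μ s l u j := by
  unfold gaussDensity
  rw [setIntegral_pi_Ioc_prod (fun m => (hlu j m).le)
    fun m t => 1 / √(s m) * stdPdf ((t - μ m) / √(s m))]
  exact Finset.prod_congr rfl fun m _ => intervalIntegral_inv_sqrt_mul_stdPdf _ _ _ _

theorem setIntegral_gaussDensity_mul_log {M J : ℕ} {μ s : Fin M → ℝ} (hs : ∀ m, 0 < s m)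
    {l u : Fin J → Fin M → ℝ} (hlu : ∀ j m, l j m < u j m) (j : Fin J) :
    ∫ z in Set.univ.pi fun m => Set.Ioc (l j m) (u j m),
        gaussDensity μ s z * Real.log (gaussDensity μ s z)
      = Wj μ s l u j * (-((M : ℝ) / 2 * Real.log (2 * Real.pi * Real.exp 1)
          + (1 / 2) * ∑ m, Real.log (s m))
          + (1 / 2) * ∑ m, Vjm μ s l u j m / Wjm μ s l u j m) := by
  have hW (m : Fin M) : ∫ t in l j m..u j m, 1 / √(s m) * stdPdf ((t - μ m) / √(s m))
      = Wjm μ s l u j m := intervalIntegral_inv_sqrt_mul_stdPdf _ _ _ _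
  have hV (m : Fin M) : (∫ t in l j m..u j m, 1 / √(s m) * stdPdf ((t - μ m) / √(s m))
        * Real.log (1 / √(s m) * stdPdf ((t - μ m) / √(s m)))) / Wjm μ s l u j m
      = -(1 / 2) * Real.log (s m) - (1 / 2) * Real.log (2 * Real.pi * Real.exp 1)
          + (1 / 2) * (Vjm μ s l u j m / Wjm μ s l u j m) := by
    have := (Wjm_pos (μ := μ) hs hlu j m).ne'
    rw [show (∫ t in l j m..u j m, 1 / √(s m) * stdPdf ((t - μ m) / √(s m))
        * Real.log (1 / √(s m) * stdPdf ((t - μ m) / √(s m))))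
        = -(1 / 2) * (Real.log (s m) + Real.log (2 * Real.pi * Real.exp 1)) * Wjm μ s l u j m
          + (1 / 2) * Vjm μ s l u j m from
      intervalIntegral_mul_log_inv_sqrt_mul_stdPdf (μ m) (hs m) _ _]
    field_simp
    ring
  unfold gaussDensity
  rw [setIntegral_pi_Ioc_prod_mul_log_prod (fun m => (hlu j m).le)
    (f := fun m t => 1 / √(s m) * stdPdf ((t - μ m) / √(s m)))
    (fun m => continuous_inv_sqrt_mul_stdPdf _ _) (fun m _ => inv_sqrt_mul_stdPdf_pos (hs m) _)
    (fun m => by rw [hW]; exact (Wjm_pos hs hlu j m).ne')]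
  simp only [hW, hV, Finset.sum_add_distrib, Finset.sum_sub_distrib, ← Finset.mul_sum,
    Finset.sum_const, Finset.card_univ, Fintype.card_fin, nsmul_eq_mul]
  rw [Wj]
  ring

/-- Closed form for the differential entropy of a product normal distribution truncated to a
finite disjoint union of boxes (Theorem 3.1 of Suzuki et al., 2020). -/
theorem entropy_truncated_product_normal
    (M J : ℕ) (hM : 1 ≤ M) (hJ : 1 ≤ J)
    (μ s : Fin M → ℝ) (hs : ∀ m, 0 < s m)
    (l u : Fin J → Fin M → ℝ) (hlu : ∀ j m, l j m < u j m)
    (hdisj : Pairwise fun j j' : Fin J => Disjoint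
        {z : Fin M → ℝ | ∀ m, l j m < z m ∧ z m ≤ u j m}
        {z : Fin M → ℝ | ∀ m, l j' m < z m ∧ z m ≤ u j' m}) :
    -∫ z in boxD l u,
        (gaussDensity μ s z / Wtot μ s l u)
          * Real.log (gaussDensity μ s z / Wtot μ s l u)
      = ((M : ℝ) / 2) * Real.log (2 * Real.pi * Real.exp 1)
          + (1 / 2) * ∑ m, Real.log (s m)
          + Real.log (Wtot μ s l u)
          - (1 / (2 * Wtot μ s l u))
              * ∑ j, Wj μ s l u j * ∑ m, Vjm μ s l u j m / Wjm μ s l u j m := by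
  have hWpos : 0 < Wtot μ s l u :=
    have : Nonempty (Fin J) := ⟨⟨0, hJ⟩⟩
    Finset.sum_pos (fun j _ => Finset.prod_pos fun m _ => Wjm_pos hs hlu j m)
      Finset.univ_nonempty
  have hq := continuous_gaussDensity μ s
  have hqlog : Continuous fun z => gaussDensity μ s z * Real.log (gaussDensity μ s z) :=
    hq.mul (hq.log fun z => (gaussDensity_pos hs z).ne')
  have hqc : Continuous fun z => Real.log (Wtot μ s l u) * gaussDensity μ s z :=
    continuous_const.mul hq
  have hsplit (z : Fin M → ℝ) :
      gaussDensity μ s z / Wtot μ s l u * Real.log (gaussDensity μ s z / Wtot μ s l u)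
        = (Wtot μ s l u)⁻¹ * (gaussDensity μ s z * Real.log (gaussDensity μ s z)
            - Real.log (Wtot μ s l u) * gaussDensity μ s z) := by
    rw [Real.log_div (gaussDensity_pos hs z).ne' hWpos.ne']
    ring
  simp_rw [hsplit, boxD, setOf_forall_lt_le_eq_pi] at hdisj ⊢
  rw [integral_const_mul, integral_iUnion_fintype
    (fun j => MeasurableSet.univ_pi fun m => measurableSet_Ioc) hdisj
    fun j => integrableOn_pi_Ioc _ _ (hqlog.fun_sub hqc)]
  have hbox (j : Fin J) := integral_sub (integrableOn_pi_Ioc (l j) (u j) hqlog)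
    (integrableOn_pi_Ioc (l j) (u j) hqc)
  simp only [integral_const_mul, setIntegral_gaussDensity_mul_log hs hlu,
    setIntegral_gaussDensity μ s hlu] at hbox
  simp only [hbox, mul_add, Finset.sum_add_distrib, Finset.sum_sub_distrib, ← Finset.sum_mul,
    ← Finset.mul_sum, mul_left_comm (Wj μ s l u _) (1 / 2 : ℝ)]
  rw [show ∑ j, Wj μ s l u j = Wtot μ s l u from rfl]
  field_simp
  ring
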